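/- Suppose w is a null-homotopic word over Q containing exactly two letters from {r, r⁻¹} and exactly two letters from {s, s⁻¹}, and the occurrences of r^{±1} and s^{±1} alternate in w (i.e. exactly one of the two occurrences of letters from {r, r⁻¹} lies between the two occurrences of letters from {s, s⁻¹}). Then FFL(w) ≤ C·ℓ(w), where C > 0 is a constant depending only on Q: w can be converted to the empty word by free reductions, free expansions, applications of relators of Q and cyclic conjugations with every intermediate word of length at most C·ℓ(w). -/

import Mathlib

/-! Words over an alphabet `A`: a letter `(x, true)` is the generator `x`,
and `(x, false)` is its formal inverse `x⁻¹`. -/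

/-- A word over the alphabet `A ∪ A⁻¹`. -/
abbrev Word (A : Type*) := List (A × Bool)

namespace Word

/-- The formal inverse of a word. -/
def inv {A : Type*} (w : Word A) : Word A := (w.map fun p => (p.1, !p.2)).reverse

/-- `w'` is a cyclic conjugate (cyclic permutation) of `w`. -/
def IsCyclicConj {A : Type*} (w w' : Word A) : Prop :=
  ∃ u v : Word A, w = u ++ v ∧ w' = v ++ u

end Word

/-- Moves (i)–(iii) on words with respect to a set `R` of relator words:
free reduction, free expansion, and application of a relator (replace a subword `u`
by `v` where some cyclic conjugate of `u * v⁻¹` lies in `R ∪ R⁻¹`). -/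
inductive Move {A : Type*} (R : Set (Word A)) : Word A → Word A → Prop
  | freeReduce (u v : Word A) (x : A) (b : Bool) :
      Move R (u ++ (x, b) :: (x, !b) :: v) (u ++ v)
  | freeExpand (u v : Word A) (x : A) (b : Bool) :
      Move R (u ++ v) (u ++ (x, b) :: (x, !b) :: v)
  | relator (p q u v z : Word A)
      (hz : Word.IsCyclicConj (u ++ Word.inv v) z) (hR : z ∈ R ∨ Word.inv z ∈ R) :
      Move R (p ++ u ++ q) (p ++ v ++ q)

/-- Moves (i)–(iv): moves (i)–(iii) together with cyclic conjugation. -/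
inductive MoveC {A : Type*} (R : Set (Word A)) : Word A → Word A → Prop
  | of {w w' : Word A} : Move R w w' → MoveC R w w'
  | cyc {w w' : Word A} : Word.IsCyclicConj w w' → MoveC R w w'

/-- Moves (i)–(v) on finite sequences of words: one of the moves (i)–(iv) applied to
one word of the sequence, or fragmentation of one word `u ++ v` into `u` and `v`. -/
inductive MoveF {A : Type*} (R : Set (Word A)) : List (Word A) → List (Word A) → Prop
  | of (l₁ l₂ : List (Word A)) {w w' : Word A} :
      MoveC R w w' → MoveF R (l₁ ++ w :: l₂) (l₁ ++ w' :: l₂)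
  | frag (l₁ l₂ : List (Word A)) (u v : Word A) :
      MoveF R (l₁ ++ (u ++ v) :: l₂) (l₁ ++ u :: v :: l₂)

/-- A word is null-homotopic over the presentation with relator set `R` if it represents
the identity of the presented group, i.e. lies in the normal closure of the relators. -/
def NullHomotopic {A : Type*} (R : Set (Word A)) (w : Word A) : Prop :=
  FreeGroup.mk w ∈ Subgroup.normalClosure (FreeGroup.mk '' R)

/-- `FLle R w L`: the word `w` can be converted to the empty word by moves (i)–(iii)
with every intermediate word of length at most `L`. -/
def FLle {A : Type*} (R : Set (Word A)) (w : Word A) (L : ℕ) : Prop :=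
  ∃ (m : ℕ) (f : ℕ → Word A), f 0 = w ∧ f m = [] ∧
    (∀ i < m, Move R (f i) (f (i + 1))) ∧ ∀ i ≤ m, (f i).length ≤ L

/-- `FFLle R w L`: the word `w` can be converted to the empty word by moves (i)–(iv)
with every intermediate word of length at most `L`. -/
def FFLle {A : Type*} (R : Set (Word A)) (w : Word A) (L : ℕ) : Prop :=
  ∃ (m : ℕ) (f : ℕ → Word A), f 0 = w ∧ f m = [] ∧
    (∀ i < m, MoveC R (f i) (f (i + 1))) ∧ ∀ i ≤ m, (f i).length ≤ L

/-- The total length of a finite sequence of words. -/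
def totalLength {A : Type*} (l : List (Word A)) : ℕ := (l.map List.length).sum

/-- `FFFLle R w L`: the length-one sequence `(w)` can be converted to a sequence of empty
words by moves (i)–(v) with every intermediate sequence of total length at most `L`. -/
def FFFLle {A : Type*} (R : Set (Word A)) (w : Word A) (L : ℕ) : Prop :=
  ∃ (m : ℕ) (f : ℕ → List (Word A)), f 0 = [w] ∧ (∀ u ∈ f m, u = ([] : Word A)) ∧
    (∀ i < m, MoveF R (f i) (f (i + 1))) ∧ ∀ i ≤ m, totalLength (f i) ≤ L

/-- An element `x` of the free group is a conjugate of a relator of `R` or of an inverse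
of a relator. -/
def IsConjRelator {A : Type*} (R : Set (Word A)) (x : FreeGroup A) : Prop :=
  ∃ c ρ : FreeGroup A, (ρ ∈ FreeGroup.mk '' R ∨ ρ⁻¹ ∈ FreeGroup.mk '' R) ∧ x = c * ρ * c⁻¹

/-- `AreaLe R g N`: in the free group, `g` is a product of at most `N` conjugates
of elements of `R ∪ R⁻¹`. -/
def AreaLe {A : Type*} (R : Set (Word A)) (g : FreeGroup A) (N : ℕ) : Prop :=
  ∃ l : List (FreeGroup A), l.length ≤ N ∧ (∀ x ∈ l, IsConjRelator R x) ∧ l.prod = g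

/-- The number of occurrences in `w` of the letter `x` or its inverse. -/
def countLtr {A : Type*} [DecidableEq A] (x : A) (w : Word A) : ℕ :=
  (w.filter fun p => p.1 = x).length

/-- The filling length `FL(w)` of a null-homotopic word. -/
noncomputable def FLw {A : Type*} (R : Set (Word A)) (w : Word A) : ℕ :=
  sInf {L | FLle R w L}

/-- The free filling length `FFL(w)` of a null-homotopic word. -/
noncomputable def FFLw {A : Type*} (R : Set (Word A)) (w : Word A) : ℕ :=
  sInf {L | FFLle R w L}

/-- The fragmenting free filling length `FFFL(w)` of a null-homotopic word. -/
noncomputable def FFFLw {A : Type*} (R : Set (Word A)) (w : Word A) : ℕ :=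
  sInf {L | FFFLle R w L}

/-- The filling length function `FL : ℕ → ℕ` of the presentation with relators `R`. -/
noncomputable def FLfn {A : Type*} (R : Set (Word A)) (n : ℕ) : ℕ :=
  sSup (FLw R '' {w | NullHomotopic R w ∧ w.length ≤ n})

/-- The free filling length function `FFL : ℕ → ℕ`. -/
noncomputable def FFLfn {A : Type*} (R : Set (Word A)) (n : ℕ) : ℕ :=
  sSup (FFLw R '' {w | NullHomotopic R w ∧ w.length ≤ n})

/-- The fragmenting free filling length function `FFFL : ℕ → ℕ`. -/
noncomputable def FFFLfn {A : Type*} (R : Set (Word A)) (n : ℕ) : ℕ :=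
  sSup (FFFLw R '' {w | NullHomotopic R w ∧ w.length ≤ n})

/-! The presentation `Q = ⟨a, b, r, s, t | a^b a⁻², [t,a], [r,at], [r,s], [s,t]⟩`. -/

/-- The five generators of the presentation `Q`. -/
inductive QGen | a | b | r | s | t
deriving DecidableEq

/-- The five relators of `Q`: `b⁻¹aba⁻¹a⁻¹`, `t⁻¹a⁻¹ta`, `r⁻¹t⁻¹a⁻¹rat`,
`r⁻¹s⁻¹rs`, `s⁻¹t⁻¹st`. -/
def QRels : Set (Word QGen) :=
  { [(QGen.b, false), (QGen.a, true), (QGen.b, true), (QGen.a, false), (QGen.a, false)],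
    [(QGen.t, false), (QGen.a, false), (QGen.t, true), (QGen.a, true)],
    [(QGen.r, false), (QGen.t, false), (QGen.a, false), (QGen.r, true), (QGen.a, true),
      (QGen.t, true)],
    [(QGen.r, false), (QGen.s, false), (QGen.r, true), (QGen.s, true)],
    [(QGen.s, false), (QGen.t, false), (QGen.s, true), (QGen.t, true)] }

/-- The word `bⁿ`. -/
def bpow (n : ℕ) : Word QGen := List.replicate n (QGen.b, true)

/-- The word `b⁻ⁿ`. -/
def bpowInv (n : ℕ) : Word QGen := List.replicate n (QGen.b, false)

/-- The word `a^{-bⁿ} = b⁻ⁿ a⁻¹ bⁿ`. -/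
def aConjNeg (n : ℕ) : Word QGen := bpowInv n ++ [(QGen.a, false)] ++ bpow n

/-- The word `a^{bⁿ} = b⁻ⁿ a bⁿ`. -/
def aConjPos (n : ℕ) : Word QGen := bpowInv n ++ [(QGen.a, true)] ++ bpow n

/-- The word `a^{-bⁿ} r a^{bⁿ}`. -/
def gword (n : ℕ) : Word QGen := aConjNeg n ++ [(QGen.r, true)] ++ aConjPos n

/-- The word `w_n = [s, a^{-bⁿ} r a^{bⁿ}] = s⁻¹ (b⁻ⁿa⁻¹bⁿ r b⁻ⁿabⁿ)⁻¹ s (b⁻ⁿa⁻¹bⁿ r b⁻ⁿabⁿ)`. -/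
def wn (n : ℕ) : Word QGen :=
  [(QGen.s, false)] ++ Word.inv (gword n) ++ [(QGen.s, true)] ++ gword n

/-- The word `a^{-bⁿ} r a^{bⁿ} r a^{bⁿ} r⁻¹ a^{-bⁿ}`. -/
def g'word (n : ℕ) : Word QGen :=
  aConjNeg n ++ [(QGen.r, true)] ++ aConjPos n ++ [(QGen.r, true)] ++ aConjPos n ++
    [(QGen.r, false)] ++ aConjNeg n

/-- The word `w'_n = [s, a^{-bⁿ} r a^{bⁿ} r a^{bⁿ} r⁻¹ a^{-bⁿ}]`. -/
def w'n (n : ℕ) : Word QGen :=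
  [(QGen.s, false)] ++ Word.inv (g'word n) ++ [(QGen.s, true)] ++ g'word n

theorem Word.inv_append {A : Type*} (u v : Word A) :
    Word.inv (u ++ v) = Word.inv v ++ Word.inv u := by
  simp [Word.inv]

theorem Word.inv_inv {A : Type*} (u : Word A) : Word.inv (Word.inv u) = u := by
  simp [Word.inv, Function.comp_def]

theorem Move.symm {A : Type*} {R : Set (Word A)} {u v : Word A} (h : Move R u v) :
    Move R v u := by
  cases h with
  | freeReduce u v x b => exact .freeExpand u v x b
  | freeExpand u v x b => exact .freeReduce u v x b
  | relator p q u v z hz hR =>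
    obtain ⟨x, y, hxy, rfl⟩ := hz
    refine .relator p q v u (Word.inv (y ++ x)) ⟨Word.inv y, Word.inv x, ?_, ?_⟩ ?_
    · rw [← Word.inv_append, ← hxy, Word.inv_append, Word.inv_inv]
    · rw [Word.inv_append]
    · rw [Word.inv_inv]
      exact hR.symm

theorem Word.isCyclicConj_iff_isRotated {A : Type*} {u v : Word A} :
    Word.IsCyclicConj u v ↔ u ~r v := by
  constructor
  · rintro ⟨x, y, rfl, rfl⟩
    exact List.isRotated_append
  · rintro ⟨n, rfl⟩
    exact ⟨_, _, (List.take_append_drop (n % u.length) u).symm,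
      List.rotate_eq_drop_append_take_mod⟩

theorem Word.IsCyclicConj.inv {A : Type*} {u v : Word A} (h : Word.IsCyclicConj u v) :
    Word.IsCyclicConj (Word.inv u) (Word.inv v) := by
  obtain ⟨x, y, rfl, rfl⟩ := h
  exact ⟨Word.inv y, Word.inv x, Word.inv_append _ _, Word.inv_append _ _⟩

theorem Move.inv {A : Type*} {R : Set (Word A)} {u v : Word A} (h : Move R u v) :
    Move R (Word.inv u) (Word.inv v) := by
  cases h with
  | freeReduce u v x b =>
    simpa [Word.inv] using Move.freeReduce (R := R) (Word.inv v) (Word.inv u) x b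
  | freeExpand u v x b =>
    simpa [Word.inv] using Move.freeExpand (R := R) (Word.inv v) (Word.inv u) x b
  | relator p q u v z hz hR =>
    simp only [Word.inv_append]
    rw [← List.append_assoc, ← List.append_assoc]
    refine Move.relator _ _ _ _ (Word.inv z) ?_ (by rwa [Word.inv_inv, or_comm])
    rw [Word.inv_inv]
    have h := hz.inv
    rw [Word.inv_append, Word.inv_inv, Word.isCyclicConj_iff_isRotated] at h
    rw [Word.isCyclicConj_iff_isRotated]
    exact List.isRotated_append.trans h

theorem Move.context {A : Type*} {R : Set (Word A)} {u v : Word A} (h : Move R u v)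
    (p q : Word A) : Move R (p ++ (u ++ q)) (p ++ (v ++ q)) := by
  cases h with
  | freeReduce u v x b => simpa using Move.freeReduce (R := R) (p ++ u) (v ++ q) x b
  | freeExpand u v x b => simpa using Move.freeExpand (R := R) (p ++ u) (v ++ q) x b
  | relator p' q' u v z hz hR =>
    simpa using Move.relator (R := R) (p ++ p') (q' ++ q) u v z hz hR

/-- `Conv R L u v`: the word `u` can be converted to `v` by moves (i)–(iii) through words
of length at most `L`. -/
def Conv {A : Type*} (R : Set (Word A)) (L : ℕ) : Word A → Word A → Prop :=
  Relation.ReflTransGen fun u v => Move R u v ∧ u.length ≤ L ∧ v.length ≤ L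

namespace Conv

variable {A : Type*} {R : Set (Word A)} {L L' : ℕ} {u v w x y : Word A}

theorem refl (u : Word A) : Conv R L u u := Relation.ReflTransGen.refl

theorem of_eq (h : u = v) : Conv R L u v := h ▸ refl u

theorem trans (h : Conv R L u v) (h' : Conv R L v w) : Conv R L u w :=
  Relation.ReflTransGen.trans h h'

theorem symm (h : Conv R L u v) : Conv R L v u :=
  haveI : Std.Symm fun u v : Word A => Move R u v ∧ u.length ≤ L ∧ v.length ≤ L :=
    ⟨fun _ _ h => ⟨h.1.symm, h.2.2, h.2.1⟩⟩
  Std.Symm.symm (r := Relation.ReflTransGen _) _ _ h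

theorem mono (h : Conv R L u v) (hL : L ≤ L') : Conv R L' u v :=
  Relation.ReflTransGen.mono (fun _ _ h => ⟨h.1, h.2.1.trans hL, h.2.2.trans hL⟩) _ _ h

theorem of_move (h : Move R u v) (hu : u.length ≤ L) (hv : v.length ≤ L) : Conv R L u v :=
  Relation.ReflTransGen.single ⟨h, hu, hv⟩

theorem context (h : Conv R L u v) (p q : Word A) :
    Conv R (p.length + L + q.length) (p ++ (u ++ q)) (p ++ (v ++ q)) := by
  refine Relation.ReflTransGen.lift (fun u => p ++ (u ++ q)) (fun u v h => ?_) _ _ h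
  refine ⟨h.1.context p q, ?_, ?_⟩ <;> simp only [List.length_append] <;> omega

/-- Convert the subword `u` of `x = p ++ u ++ q` to `v`, then go on. -/
theorem step (h : Conv R L u v) (p q : Word A) (hx : x = p ++ (u ++ q))
    (hL : p.length + L + q.length ≤ L') (hy : Conv R L' (p ++ (v ++ q)) y) : Conv R L' x y :=
  hx ▸ ((h.context p q).mono hL).trans hy

theorem cancel (g : A) (b : Bool) : Conv R 2 [(g, b), (g, !b)] [] :=
  of_move (.freeReduce [] [] g b) (by simp) (by simp)

theorem replicate_comm {c d : A × Bool} (h : Conv R L [c, d] [d, c]) (n : ℕ) :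
    Conv R (L + n) (c :: List.replicate n d) (List.replicate n d ++ [c]) := by
  induction n with
  | zero => exact refl _
  | succ n ih =>
    refine h.step [] (List.replicate n d) (by simp [List.replicate_succ]) (by simp) ?_
    refine ih.step [d] [] (by simp) (by simp; omega) ?_
    exact of_eq (by simp [List.replicate_succ])

theorem cancel' (g : A) (b : Bool) : Conv R 2 [(g, !b), (g, b)] [] := by
  simpa using cancel (R := R) g (!b)

theorem replicate_cancel (g : A) (b : Bool) (n : ℕ) :
    Conv R (2 * n) (List.replicate n (g, b) ++ List.replicate n (g, !b)) [] := by
  induction n with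
  | zero => exact refl _
  | succ n ih =>
    refine (cancel g b).step (List.replicate n (g, b)) (List.replicate n (g, !b)) ?_
      (by simp; omega) (ih.mono (by omega))
    rw [List.replicate_succ', List.replicate_succ]
    simp

theorem of_isRotated {z : Word A} (hz : z ∈ R)
    (h : u ++ Word.inv v ~r z ∨ u ++ Word.inv v ~r Word.inv z)
    (hu : u.length ≤ L) (hv : v.length ≤ L) : Conv R L u v := by
  simp only [← Word.isCyclicConj_iff_isRotated] at h
  have key : ∀ z', Word.IsCyclicConj (u ++ Word.inv v) z' → (z' ∈ R ∨ Word.inv z' ∈ R) →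
      Conv R L u v := fun z' h hz' =>
    of_move (by simpa using Move.relator (R := R) [] [] u v _ h hz') hu hv
  rcases h with h | h
  · exact key z h (.inl hz)
  · exact key _ h (.inr (by rwa [Word.inv_inv]))

theorem inv (h : Conv R L u v) : Conv R L (Word.inv u) (Word.inv v) := by
  refine Relation.ReflTransGen.lift Word.inv (fun u v h => ?_) _ _ h
  exact ⟨h.1.inv, by simpa [Word.inv] using h.2.1, by simpa [Word.inv] using h.2.2⟩

end Conv

namespace QGen

/-- Conversion over the presentation `Q`. -/
abbrev QConv : ℕ → Word QGen → Word QGen → Prop := Conv QRels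

theorem conv_a_b (δ : Bool) : QConv 3 [(b, false), (a, δ), (b, true)] [(a, δ), (a, δ)] := by
  refine Conv.of_isRotated (z := [(b, false), (a, true), (b, true), (a, false), (a, false)])
    (by simp [QRels]) ?_ (by simp) (by simp)
  revert δ
  decide

theorem conv_a_t (δ ε : Bool) : QConv 2 [(a, δ), (t, ε)] [(t, ε), (a, δ)] := by
  refine Conv.of_isRotated (z := [(t, false), (a, false), (t, true), (a, true)])
    (by simp [QRels]) ?_ (by simp) (by simp)
  revert δ ε
  decide

theorem conv_r_s (δ ε : Bool) : QConv 2 [(r, δ), (s, ε)] [(s, ε), (r, δ)] := by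
  refine Conv.of_isRotated (z := [(r, false), (s, false), (r, true), (s, true)])
    (by simp [QRels]) ?_ (by simp) (by simp)
  revert δ ε
  decide

theorem conv_s_t (δ ε : Bool) : QConv 2 [(s, δ), (t, ε)] [(t, ε), (s, δ)] := by
  refine Conv.of_isRotated (z := [(s, false), (t, false), (s, true), (t, true)])
    (by simp [QRels]) ?_ (by simp) (by simp)
  revert δ ε
  decide

theorem conv_conj_a_r (δ ε : Bool) :
    QConv 5 [(a, δ), (r, ε), (a, !δ)] [(t, !δ), (r, ε), (t, δ)] := by
  have hz : [(r, false), (t, false), (a, false), (r, true), (a, true), (t, true)] ∈ QRels := by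
    simp [QRels]
  cases δ
  · refine Conv.of_isRotated hz ?_ (by simp) (by simp)
    revert ε
    decide
  · refine Conv.symm ?_
    refine (Conv.cancel a true).symm.step [(t, false), (r, ε), (t, true)] [] (by simp)
      (by simp) ?_
    refine (conv_a_t true true).symm.step [(t, false), (r, ε)] [(a, false)] (by simp)
      (by simp) ?_
    have h : QConv 3 [(r, ε), (a, true), (t, true)] [(a, true), (t, true), (r, ε)] := by
      refine Conv.of_isRotated hz ?_ (by simp) (by simp)
      revert ε
      decide
    refine h.step [(t, false)] [(a, false)] (by simp) (by simp) ?_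
    refine (conv_a_t true true).step [(t, false)] [(r, ε), (a, false)] (by simp) (by simp) ?_
    refine (Conv.cancel t false).step [] [(a, true), (r, ε), (a, false)] (by simp) (by simp) ?_
    exact Conv.of_eq (by simp)

/-- A word of length `O(log n)` representing `aⁿ` (`σ = true`) or `a⁻ⁿ` (`σ = false`). -/
def natPow (σ : Bool) (n : ℕ) : Word QGen :=
  if _h : n = 0 then [] else
    (if n % 2 = 1 then [(a, σ)] else []) ++ (b, false) :: (natPow σ (n / 2) ++ [(b, true)])
termination_by n

/-- A word of length `O(log |m|)` representing `aᵐ`. -/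
def aPow (m : ℤ) : Word QGen := natPow (decide (0 ≤ m)) m.natAbs

@[simp] theorem natPow_zero (σ : Bool) : natPow σ 0 = [] := by rw [natPow]; simp

@[simp] theorem aPow_zero : aPow 0 = [] := by simp [aPow]

theorem natPow_two_mul (σ : Bool) {n : ℕ} (hn : n ≠ 0) :
    natPow σ (2 * n) = (b, false) :: (natPow σ n ++ [(b, true)]) := by
  rw [natPow]; simp [hn]

theorem natPow_two_mul_add_one (σ : Bool) (n : ℕ) :
    natPow σ (2 * n + 1) = (a, σ) :: (b, false) :: (natPow σ n ++ [(b, true)]) := by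
  rw [natPow]
  have : (2 * n + 1) / 2 = n := by omega
  simp [this]

theorem length_natPow_le (σ : Bool) (N n : ℕ) (h : n < 2 ^ N) :
    (natPow σ n).length ≤ 3 * N := by
  induction N generalizing n with
  | zero => simp_all
  | succ N ih =>
    rw [natPow]
    split_ifs with h0 h1
    · simp
    all_goals
      have := ih (n / 2) (by omega)
      simp only [List.length_append, List.length_cons, List.length_nil]
      omega

theorem length_aPow_le {N : ℕ} {m : ℤ} (h : m.natAbs < 2 ^ N) : (aPow m).length ≤ 3 * N :=
  length_natPow_le _ _ _ h

theorem conv_natPow_succ (σ : Bool) (n : ℕ) :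
    QConv ((natPow σ n).length + 5) ((a, σ) :: natPow σ n) (natPow σ (n + 1)) := by
  induction n using Nat.strong_induction_on with
  | _ n ih =>
    obtain ⟨k, rfl | rfl⟩ := Nat.even_or_odd' n
    · rw [natPow_two_mul_add_one]
      rcases eq_or_ne k 0 with rfl | hk
      · refine (Conv.cancel b false).symm.step [(a, σ)] [] (by simp) (by simp) ?_
        exact Conv.of_eq (by simp)
      · rw [natPow_two_mul σ hk]
        exact Conv.refl _
    · rw [show 2 * k + 1 + 1 = 2 * (k + 1) by ring, natPow_two_mul σ (Nat.succ_ne_zero k),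
        natPow_two_mul_add_one]
      refine (conv_a_b σ).symm.step [] ((b, false) :: (natPow σ k ++ [(b, true)])) (by simp)
        (by simp; omega) ?_
      refine (Conv.cancel b true).step [(b, false), (a, σ)] (natPow σ k ++ [(b, true)])
        (by simp) (by simp; omega) ?_
      refine (ih k (by omega)).step [(b, false)] [(b, true)] (by simp) (by simp; omega) ?_
      exact Conv.of_eq (by simp)

/-- The sign `±1` encoded by a Boolean. -/
def sgn (δ : Bool) : ℤ := if δ then 1 else -1

@[simp] theorem sgn_true : sgn true = 1 := rfl
@[simp] theorem sgn_false : sgn false = -1 := rfl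
@[simp] theorem sgn_not (δ : Bool) : sgn (!δ) = -sgn δ := by cases δ <;> rfl

theorem aPow_natCast (n : ℕ) : aPow n = natPow true n := by simp [aPow]

theorem aPow_neg_natCast (n : ℕ) : aPow (-n) = natPow false n := by
  rcases eq_or_ne n 0 with rfl | hn
  · simp
  · simp [aPow, hn]

theorem exists_natPow_eq_aPow (m : ℤ) :
    ∃ (σ : Bool) (n : ℕ), m = sgn σ * n := by
  rcases Int.eq_nat_or_neg m with ⟨n, rfl | rfl⟩
  · exact ⟨true, n, by simp⟩
  · exact ⟨false, n, by simp⟩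

theorem aPow_sgn_mul (σ : Bool) (n : ℕ) : aPow (sgn σ * n) = natPow σ n := by
  cases σ
  · simp [aPow_neg_natCast]
  · simp [aPow_natCast]

theorem conv_a_aPow (δ : Bool) {N : ℕ} {m : ℤ} (h : m.natAbs < 2 ^ N) :
    QConv (3 * N + 6) ((a, δ) :: aPow m) (aPow (m + sgn δ)) := by
  obtain ⟨σ, n, rfl⟩ := exists_natPow_eq_aPow m
  have hl := length_aPow_le h
  rw [aPow_sgn_mul] at hl ⊢
  by_cases hδ : σ = δ
  · subst hδ
    rw [show sgn σ * n + sgn σ = sgn σ * (n + 1 : ℕ) by push_cast; ring, aPow_sgn_mul]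
    exact (conv_natPow_succ σ n).mono (by omega)
  · have hδ' : δ = !σ := by cases σ <;> cases δ <;> simp_all
    subst hδ'
    rcases n with _ | n
    · rw [show sgn σ * (0 : ℕ) + sgn (!σ) = sgn (!σ) * (1 : ℕ) by simp, aPow_sgn_mul]
      have h1 := conv_natPow_succ (!σ) 0
      simp only [natPow_zero, List.length_nil] at h1 ⊢
      exact h1.mono (by omega)
    · rw [show sgn σ * (n + 1 : ℕ) + sgn (!σ) = sgn σ * n by push_cast; simp; ring, aPow_sgn_mul]
      have hl' : (natPow σ n).length ≤ 3 * N := by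
        refine length_natPow_le _ _ _ (lt_trans ?_ h)
        cases σ <;> simp <;> omega
      refine (conv_natPow_succ σ n).symm.step [(a, !σ)] [] (by simp) (by simp; omega) ?_
      refine (Conv.cancel' a σ).step [] (natPow σ n) (by simp) (by simp; omega) ?_
      exact Conv.of_eq (by simp)

theorem conv_comm_self (g : QGen) (δ ε : Bool) : QConv 2 [(g, δ), (g, ε)] [(g, ε), (g, δ)] := by
  by_cases h : δ = ε
  · subst h
    exact Conv.refl _
  · obtain rfl : ε = !δ := by cases ε <;> cases δ <;> simp_all
    exact (Conv.cancel g δ).trans (Conv.cancel' g δ).symm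

theorem natAbs_sgn_mul (σ : Bool) (n : ℕ) : (sgn σ * n).natAbs = n := by
  cases σ <;> simp

/-- The mirror image of `aPow m`. -/
def aPowMirror (m : ℤ) : Word QGen := Word.inv (aPow (-m))

theorem length_aPowMirror_le {N : ℕ} {m : ℤ} (h : m.natAbs < 2 ^ N) :
    (aPowMirror m).length ≤ 3 * N := by
  simpa [aPowMirror, Word.inv] using length_aPow_le (m := -m) (by simpa using h)

theorem conv_aPowMirror_a (δ : Bool) {N : ℕ} {m : ℤ} (h : m.natAbs < 2 ^ N) :
    QConv (3 * N + 6) (aPowMirror m ++ [(a, δ)]) (aPowMirror (m + sgn δ)) := by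
  have := (conv_a_aPow (!δ) (m := -m) (by simpa using h)).inv
  rw [sgn_not, ← neg_add] at this
  simpa [aPowMirror, Word.inv] using this

theorem conv_comm_aPowMirror {x : Word QGen} (hx : x.length ≤ 1)
    (hxa : ∀ δ, QConv 2 (x ++ [(a, δ)]) ((a, δ) :: x)) {N : ℕ} {m : ℤ} (h : m.natAbs < 2 ^ N) :
    QConv (6 * N + 7) (x ++ aPow m) (aPowMirror m ++ x) := by
  obtain ⟨σ, n, rfl⟩ := exists_natPow_eq_aPow m
  rw [natAbs_sgn_mul] at h
  have key : ∀ j i : ℕ, i + j < 2 ^ N →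
      QConv (6 * N + 7) (aPowMirror (sgn σ * i) ++ (x ++ aPow (sgn σ * j)))
        (aPowMirror (sgn σ * (i + j : ℕ)) ++ x) := by
    intro j
    induction j with
    | zero => exact fun i _ => Conv.of_eq (by simp)
    | succ j ih =>
      intro i hij
      have hi : (sgn σ * i).natAbs < 2 ^ N := by rw [natAbs_sgn_mul]; omega
      have hj : (sgn σ * j).natAbs < 2 ^ N := by rw [natAbs_sgn_mul]; omega
      have hli := length_aPowMirror_le hi
      have hlj := length_aPow_le hj
      have hsi := conv_aPowMirror_a σ hi
      have hsj := conv_a_aPow σ hj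
      rw [show sgn σ * i + sgn σ = sgn σ * (i + 1 : ℕ) by push_cast; ring] at hsi
      rw [show sgn σ * j + sgn σ = sgn σ * (j + 1 : ℕ) by push_cast; ring] at hsj
      refine hsj.symm.step (aPowMirror (sgn σ * i) ++ x) [] (by simp) (by simp; omega) ?_
      refine (hxa σ).step (aPowMirror (sgn σ * i)) (aPow (sgn σ * j)) (by simp)
        (by omega) ?_
      refine hsi.step [] (x ++ aPow (sgn σ * j)) (by simp) (by simp; omega) ?_
      have := ih (i + 1) (by omega)
      rw [show i + 1 + j = i + (j + 1) by ring] at this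
      exact this
  simpa [aPowMirror, Word.inv] using key n 0 (by omega)

/-- A letter commuting with `a` commutes with `aPow m`. -/
theorem conv_comm_aPow {x : QGen × Bool} (hx : ∀ δ, QConv 2 [x, (a, δ)] [(a, δ), x])
    {N : ℕ} {m : ℤ} (h : m.natAbs < 2 ^ N) :
    QConv (6 * N + 8) (x :: aPow m) (aPow m ++ [x]) := by
  refine ((conv_comm_aPowMirror (x := [x]) (by simp) hx h).mono (by omega)).trans ?_
  refine (conv_comm_aPowMirror (x := []) (by simp) (fun δ => Conv.refl _) h).symm.step
    [] [x] (by simp) (by simp) ?_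
  exact Conv.of_eq (by simp)

theorem conv_t_aPow (δ : Bool) {N : ℕ} {m : ℤ} (h : m.natAbs < 2 ^ N) :
    QConv (6 * N + 8) ((t, δ) :: aPow m) (aPow m ++ [(t, δ)]) :=
  conv_comm_aPow (fun _ => (conv_a_t _ _).symm) h

theorem conv_aPow_a (δ : Bool) {N : ℕ} {m : ℤ} (h : m.natAbs < 2 ^ N) :
    QConv (6 * N + 8) (aPow m ++ [(a, δ)]) (aPow (m + sgn δ)) :=
  (conv_comm_aPow (fun _ => conv_comm_self _ _ _) h).symm.trans ((conv_a_aPow δ h).mono (by omega))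

/-- The word `tᵏ`. -/
def tPow (k : ℤ) : Word QGen := List.replicate k.natAbs (t, decide (0 ≤ k))

@[simp] theorem tPow_zero : tPow 0 = [] := rfl

@[simp] theorem length_tPow (k : ℤ) : (tPow k).length = k.natAbs := by simp [tPow]

theorem tPow_sgn_mul (σ : Bool) (n : ℕ) : tPow (sgn σ * n) = List.replicate n (t, σ) := by
  rcases eq_or_ne n 0 with rfl | hn
  · simp
  · cases σ <;> simp [tPow, hn]

theorem conv_tPow_t (δ : Bool) (k : ℤ) :
    QConv (k.natAbs + 1) (tPow k ++ [(t, δ)]) (tPow (k + sgn δ)) := by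
  obtain ⟨σ, n, rfl⟩ := exists_natPow_eq_aPow k
  rw [tPow_sgn_mul, natAbs_sgn_mul]
  by_cases h : σ = δ
  · subst h
    rw [show sgn σ * n + sgn σ = sgn σ * (n + 1 : ℕ) by push_cast; ring, tPow_sgn_mul]
    exact Conv.of_eq List.replicate_succ'.symm
  · obtain rfl : δ = !σ := by cases σ <;> cases δ <;> simp_all
    rcases n with _ | n
    · rw [show sgn σ * (0 : ℕ) + sgn (!σ) = sgn (!σ) * (1 : ℕ) by simp, tPow_sgn_mul]
      exact Conv.of_eq (by simp)
    · rw [show sgn σ * (n + 1 : ℕ) + sgn (!σ) = sgn σ * n by push_cast; simp; ring,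
        tPow_sgn_mul, List.replicate_succ']
      refine (Conv.cancel t σ).step (List.replicate n (t, σ)) [] (by simp) (by simp) ?_
      exact Conv.of_eq (by simp)

theorem conv_tPow_tPow_neg (k : ℤ) : QConv (2 * k.natAbs) (tPow k ++ tPow (-k)) [] := by
  obtain ⟨σ, n, rfl⟩ := exists_natPow_eq_aPow k
  rw [show -(sgn σ * n) = sgn (!σ) * n by simp, tPow_sgn_mul, tPow_sgn_mul, natAbs_sgn_mul]
  exact Conv.replicate_cancel t σ n

theorem conv_comm_tPow {x : QGen × Bool} (hx : ∀ δ, QConv 2 [x, (t, δ)] [(t, δ), x]) (k : ℤ) :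
    QConv (k.natAbs + 2) (x :: tPow k) (tPow k ++ [x]) :=
  (Conv.replicate_comm (hx _) _).mono (by omega)

theorem conv_t_tPow (δ : Bool) (k : ℤ) :
    QConv (k.natAbs + 2) ((t, δ) :: tPow k) (tPow (k + sgn δ)) :=
  (conv_comm_tPow (fun _ => conv_comm_self _ _ _) k).trans ((conv_tPow_t δ k).mono (by omega))

theorem conv_tPow_aPow (k : ℤ) {N : ℕ} {m : ℤ} (h : m.natAbs < 2 ^ N) :
    QConv (6 * N + 8 + k.natAbs) (tPow k ++ aPow m) (aPow m ++ tPow k) := by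
  unfold tPow
  generalize decide (0 ≤ k) = δ
  induction k.natAbs with
  | zero => exact Conv.of_eq (by simp)
  | succ n ih =>
    refine ih.step [(t, δ)] [] (by simp [List.replicate_succ]) (by simp; omega) ?_
    refine (conv_t_aPow δ h).step [] (List.replicate n (t, δ)) (by simp) (by simp) ?_
    exact Conv.of_eq (by simp [List.replicate_succ])

/-- The word `aᵐ r^{±1} a⁻ᵐ`. -/
def conjR (ε : Bool) (m : ℤ) : Word QGen := aPow m ++ (r, ε) :: aPow (-m)

theorem length_conjR_le (ε : Bool) {N : ℕ} {m : ℤ} (h : m.natAbs < 2 ^ N) :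
    (conjR ε m).length ≤ 6 * N + 1 := by
  have h1 := length_aPow_le h
  have h2 := length_aPow_le (m := -m) (by simpa using h)
  simp only [conjR, List.length_append, List.length_cons]
  omega

theorem conv_conjR_succ (ε δ : Bool) {N : ℕ} {m : ℤ} (h : m.natAbs < 2 ^ N)
    (h' : (m + sgn δ).natAbs < 2 ^ N) :
    QConv (9 * N + 13) (conjR ε (m + sgn δ)) ((t, !δ) :: (conjR ε m ++ [(t, δ)])) := by
  have hm : (-m).natAbs < 2 ^ N := by simpa using h
  have hm' : (-(m + sgn δ)).natAbs < 2 ^ N := by rwa [Int.natAbs_neg]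
  have l1 := length_aPow_le h
  have l2 := length_aPow_le hm
  have l3 := length_aPow_le hm'
  refine (conv_aPow_a δ h).symm.step [] ((r, ε) :: aPow (-(m + sgn δ))) (by simp [conjR])
    (by simp only [List.length_cons, List.length_nil]; omega) ?_
  have h1 := conv_a_aPow (!δ) hm
  rw [show -m + sgn (!δ) = -(m + sgn δ) by rw [sgn_not]; ring] at h1
  refine h1.symm.step (aPow m ++ [(a, δ), (r, ε)]) [] (by simp) (by simp; omega) ?_
  refine (conv_conj_a_r δ ε).step (aPow m) (aPow (-m)) (by simp) (by omega) ?_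
  refine (conv_t_aPow (!δ) h).symm.step [] ((r, ε) :: (t, δ) :: aPow (-m)) (by simp)
    (by simp; omega) ?_
  refine (conv_t_aPow δ hm).step ((t, !δ) :: (aPow m ++ [(r, ε)])) [] (by simp)
    (by simp; omega) ?_
  exact Conv.of_eq (by simp [conjR])

/-- The word `tᵏ aᵐ r^{±1} a⁻ᵐ tˡ`. -/
def block (ε : Bool) (k m l : ℤ) : Word QGen := tPow k ++ (conjR ε m ++ tPow l)

theorem length_block_le (ε : Bool) {N : ℕ} (k : ℤ) {m : ℤ} (l : ℤ) (h : m.natAbs < 2 ^ N) :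
    (block ε k m l).length ≤ k.natAbs + l.natAbs + 6 * N + 1 := by
  have := length_conjR_le ε h
  simp only [block, List.length_append, length_tPow]
  omega

theorem conv_block (ε : Bool) {N : ℕ} (k m l d : ℤ) (h : m.natAbs + d.natAbs < 2 ^ N) :
    QConv (9 * N + k.natAbs + l.natAbs + 2 * d.natAbs + 20) (block ε k m l)
      (block ε (k - d) (m - d) (l + d)) := by
  obtain ⟨σ, n, rfl⟩ := exists_natPow_eq_aPow d
  rw [natAbs_sgn_mul] at h ⊢
  induction n with
  | zero => exact Conv.of_eq (by simp)
  | succ n ih =>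
    refine ((ih (by omega)).mono (by omega)).trans ?_
    have hs : sgn σ * (n + 1 : ℕ) = sgn σ * n + sgn σ := by push_cast; ring
    have h1 : (m - sgn σ * (n + 1 : ℕ)).natAbs < 2 ^ N := by
      have := natAbs_sgn_mul σ (n + 1); omega
    have h2 : (m - sgn σ * (n + 1 : ℕ) + sgn σ).natAbs < 2 ^ N := by
      have := natAbs_sgn_mul σ n
      rw [show m - sgn σ * (n + 1 : ℕ) + sgn σ = m - sgn σ * n by rw [hs]; ring]; omega
    have hk : (k - sgn σ * n).natAbs ≤ k.natAbs + n := by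
      have := natAbs_sgn_mul σ n; omega
    have hl : (l + sgn σ * n).natAbs ≤ l.natAbs + n := by
      have := natAbs_sgn_mul σ n; omega
    have h3 := conv_conjR_succ ε σ h1 h2
    rw [show m - sgn σ * (n + 1 : ℕ) + sgn σ = m - sgn σ * n by rw [hs]; ring] at h3
    have lc := length_conjR_le ε h1
    refine h3.step (tPow (k - sgn σ * n)) (tPow (l + sgn σ * n)) rfl (by simp; omega) ?_
    have h4 := conv_tPow_t (!σ) (k - sgn σ * n)
    rw [show k - sgn σ * n + sgn (!σ) = k - sgn σ * (n + 1 : ℕ) by rw [hs, sgn_not]; ring] at h4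
    refine h4.step [] (conjR ε (m - sgn σ * (n + 1 : ℕ)) ++ [(t, σ)] ++ tPow (l + sgn σ * n))
      (by simp) ?_ ?_
    · simp only [List.length_append, List.length_cons, List.length_nil, length_tPow]; omega
    have h5 := conv_t_tPow σ (l + sgn σ * n)
    rw [show l + sgn σ * n + sgn σ = l + sgn σ * (n + 1 : ℕ) by rw [hs]; ring] at h5
    refine h5.step (tPow (k - sgn σ * (n + 1 : ℕ)) ++ conjR ε (m - sgn σ * (n + 1 : ℕ))) []
      (by simp) ?_ ?_
    · have := natAbs_sgn_mul σ (n + 1)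
      simp only [List.length_append, length_tPow, List.length_nil]; omega
    · exact Conv.of_eq (by simp [block])

end QGen

/-- `ConvC R L u v`: the word `u` can be converted to `v` by moves (i)–(iv) through words
of length at most `L`. -/
def ConvC {A : Type*} (R : Set (Word A)) (L : ℕ) : Word A → Word A → Prop :=
  Relation.ReflTransGen fun u v => MoveC R u v ∧ u.length ≤ L ∧ v.length ≤ L

namespace ConvC

variable {A : Type*} {R : Set (Word A)} {L L' : ℕ} {u v w : Word A}

theorem trans (h : ConvC R L u v) (h' : ConvC R L v w) : ConvC R L u w :=
  Relation.ReflTransGen.trans h h'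

theorem mono (h : ConvC R L u v) (hL : L ≤ L') : ConvC R L' u v :=
  Relation.ReflTransGen.mono (fun _ _ h => ⟨h.1, h.2.1.trans hL, h.2.2.trans hL⟩) _ _ h

theorem rotate (u v : Word A) (h : u.length + v.length ≤ L) : ConvC R L (u ++ v) (v ++ u) :=
  Relation.ReflTransGen.single ⟨.cyc ⟨u, v, rfl, rfl⟩, by simpa, by simpa [add_comm] using h⟩

theorem ffle (h : ConvC R L w []) (hw : w.length ≤ L) : FFLle R w L := by
  induction h using Relation.ReflTransGen.head_induction_on with
  | refl => exact ⟨0, fun _ => [], rfl, rfl, by simp, by simp⟩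
  | @head x _ h _ ih =>
    obtain ⟨m, f, h0, hm, hf, hl⟩ := ih h.2.2
    refine ⟨m + 1, fun i => Nat.casesOn i x f, rfl, hm, ?_, ?_⟩
    · rintro (_ | i) hi
      · simpa [h0] using h.1
      · exact hf i (by omega)
    · rintro (_ | i) hi
      · exact hw
      · exact hl i (by omega)

end ConvC

theorem Conv.convC {A : Type*} {R : Set (Word A)} {L : ℕ} {u v : Word A} (h : Conv R L u v) :
    ConvC R L u v :=
  Relation.ReflTransGen.mono (fun _ _ h => ⟨.of h.1, h.2⟩) _ _ h

namespace QGen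

/-- The commutator word `[s^{±1}, aᵐ r^{±1} a⁻ᵐ]`, up to inversion. -/
def commSR (e ε : Bool) (m : ℤ) : Word QGen :=
  (s, e) :: (conjR ε m ++ (s, !e) :: conjR (!ε) m)

theorem convC_commSR_succ (e ε δ : Bool) {N : ℕ} {m : ℤ} (h : m.natAbs < 2 ^ N)
    (h' : (m + sgn δ).natAbs < 2 ^ N) :
    ConvC QRels (15 * N + 20) (commSR e ε (m + sgn δ)) (commSR e ε m) := by
  have l1 := length_conjR_le ε h
  have l2 := length_conjR_le (!ε) h
  have l3 := length_conjR_le (!ε) h'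
  have h1 : QConv (15 * N + 20) (commSR e ε (m + sgn δ))
      ([(t, !δ)] ++ ((s, e) :: (conjR ε m ++ (s, !e) :: (t, δ) :: conjR (!ε) (m + sgn δ)))) := by
    refine (conv_conjR_succ ε δ h h').step [(s, e)] ((s, !e) :: conjR (!ε) (m + sgn δ))
      (by simp [commSR]) (by simp; omega) ?_
    refine (conv_s_t e (!δ)).step []
      (conjR ε m ++ (t, δ) :: (s, !e) :: conjR (!ε) (m + sgn δ)) (by simp) (by simp; omega) ?_
    refine (conv_s_t (!e) δ).symm.step ((t, !δ) :: (s, e) :: conjR ε m)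
      (conjR (!ε) (m + sgn δ)) (by simp) (by simp; omega) ?_
    exact Conv.of_eq (by simp)
  refine h1.convC.trans ((ConvC.rotate _ _ (by simp; omega)).trans (Conv.convC ?_))
  refine (conv_conjR_succ (!ε) δ h h').step ((s, e) :: (conjR ε m ++ [(s, !e), (t, δ)]))
    [(t, !δ)] (by simp) (by simp; omega) ?_
  refine (Conv.cancel t δ).step ((s, e) :: (conjR ε m ++ [(s, !e)]))
    (conjR (!ε) m ++ [(t, δ), (t, !δ)]) (by simp) (by simp; omega) ?_
  refine (Conv.cancel t δ).step ((s, e) :: (conjR ε m ++ (s, !e) :: conjR (!ε) m))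
    [] (by simp) (by simp; omega) ?_
  exact Conv.of_eq (by simp [commSR])

theorem convC_commSR (e ε : Bool) {N : ℕ} {m : ℤ} (h : m.natAbs < 2 ^ N) :
    ConvC QRels (15 * N + 20) (commSR e ε m) [] := by
  obtain ⟨σ, n, rfl⟩ := exists_natPow_eq_aPow m
  rw [natAbs_sgn_mul] at h
  induction n with
  | zero =>
    refine Conv.convC ?_
    refine (conv_r_s ε (!e)).step [(s, e)] [(r, !ε)] (by simp [commSR, conjR]) (by simp) ?_
    refine (Conv.cancel s e).step [] [(r, ε), (r, !ε)] (by simp) (by simp) ?_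
    exact (Conv.cancel r ε).mono (by omega)
  | succ n ih =>
    have h1 := convC_commSR_succ e ε σ (N := N) (m := sgn σ * n)
      (by rw [natAbs_sgn_mul]; omega)
    rw [show sgn σ * n + sgn σ = sgn σ * (n + 1 : ℕ) by push_cast; ring, natAbs_sgn_mul] at h1
    exact (h1 h).trans (ih (by omega))

theorem convC_block_block (e ε : Bool) {N D : ℕ} {m m' k₁ k₂ k₃ k₄ : ℤ}
    (h₂ : k₂ + m + (k₃ - m') = 0) (h₁ : k₁ - m + (k₄ + m') = 0)
    (hk₁ : k₁.natAbs ≤ D) (hk₂ : k₂.natAbs ≤ D) (hk₃ : k₃.natAbs ≤ D) (hk₄ : k₄.natAbs ≤ D)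
    (hm : m.natAbs < 2 ^ N) (hm' : m'.natAbs + 2 * D < 2 ^ N) :
    ConvC QRels (15 * N + 8 * D + 30)
      ((s, e) :: (block ε k₁ m k₂ ++ (s, !e) :: block (!ε) k₃ m' k₄)) [] := by
  have hb := conv_block (!ε) (N := N) k₃ m' k₄ (m' - m) (by omega)
  rw [show k₃ - (m' - m) = -k₂ by linarith, show k₄ + (m' - m) = -k₁ by linarith,
    sub_sub_cancel] at hb
  have l1 := length_block_le ε k₁ k₂ hm
  have l2 := length_conjR_le ε hm
  have l3 := length_conjR_le (!ε) hm
  have h1 : QConv (15 * N + 8 * D + 30)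
      ((s, e) :: (block ε k₁ m k₂ ++ (s, !e) :: block (!ε) k₃ m' k₄))
      (tPow k₁ ++ (commSR e ε m ++ tPow (-k₁))) := by
    refine hb.step ((s, e) :: (block ε k₁ m k₂ ++ [(s, !e)])) [] (by simp)
      (by simp; omega) ?_
    refine (conv_comm_tPow (conv_s_t e) k₁).step []
      (conjR ε m ++ (tPow k₂ ++ (s, !e) :: block (!ε) (-k₂) m (-k₁))) (by simp [block])
      (by simp [block]; omega) ?_
    refine (conv_comm_tPow (conv_s_t (!e)) k₂).symm.step (tPow k₁ ++ (s, e) :: conjR ε m)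
      (block (!ε) (-k₂) m (-k₁)) (by simp) (by simp [block]; omega) ?_
    refine (conv_tPow_tPow_neg k₂).step (tPow k₁ ++ (s, e) :: (conjR ε m ++ [(s, !e)]))
      (conjR (!ε) m ++ tPow (-k₁)) (by simp [block]) (by simp; omega) ?_
    exact Conv.of_eq (by simp [commSR])
  have lc : (commSR e ε m).length ≤ 12 * N + 4 := by simp [commSR]; omega
  refine h1.convC.trans ((ConvC.rotate _ _ (by simp; omega)).trans ?_)
  refine ConvC.trans (Conv.convC ?_) ((convC_commSR e ε hm).mono (by omega))
  have h2 := conv_tPow_tPow_neg (-k₁)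
  rw [neg_neg] at h2
  refine h2.step (commSR e ε m) [] (by simp) (by simp; omega) ?_
  exact Conv.of_eq (by simp)

/-- The syllables of the normal form of an element of the subgroup `⟨a, b, t⟩`:
`t^{±1}`, `b⁻¹` and `b a^ρ` with `ρ ∈ {0, 1}`. -/
inductive Syl
  | t (δ : Bool)
  | bNeg
  | bPos (ρ : Bool)

/-- Whether a syllable may be followed by another one in a normal form. -/
def Syl.Compat : Syl → Syl → Prop
  | .t δ, .t ε => δ = ε
  | .bNeg, .bPos _ => False
  | .bPos false, .bNeg => False
  | _, _ => True

/-- The word `a^ρ`, where `ρ ∈ {0, 1}`. -/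
def aBit (ρ : Bool) : Word QGen := if ρ then [(a, true)] else []

/-- The word spelled by a syllable. -/
def Syl.word : Syl → Word QGen
  | .t δ => [(QGen.t, δ)]
  | .bNeg => [(b, false)]
  | .bPos ρ => (b, true) :: aBit ρ

/-- `(m, l)` stands for `aᵐ` followed by the syllables in `l`. -/
abbrev PreState := ℤ × List Syl

/-- The word spelled by a state. -/
def PreState.word (x : PreState) : Word QGen := aPow x.1 ++ x.2.flatMap Syl.word

/-- Left multiplication of a normal form by `t^{±1}`. -/
def actT (δ : Bool) : PreState → PreState
  | (m, .t ε :: l) => if ε = δ then (m, .t δ :: .t ε :: l) else (m, l)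
  | (m, l) => (m, .t δ :: l)

/-- Left multiplication of a normal form by `b⁻¹`. -/
def actBNeg : PreState → PreState
  | (m, .bPos ρ :: l) => (2 * m + ρ.toInt, l)
  | (m, l) => (2 * m, .bNeg :: l)

/-- Left multiplication of `aᵐ l` by `b`, where `m = 2 * q + ρ`. -/
def actBPos (q : ℤ) : Bool → List Syl → PreState
  | false, .bNeg :: l => (q, l)
  | ρ, l => (q, .bPos ρ :: l)

/-- Left multiplication of a normal form by a letter `a^{±1}`, `b^{±1}` or `t^{±1}`. -/
def act : QGen × Bool → PreState → PreState
  | (a, δ), x => (x.1 + sgn δ, x.2)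
  | (b, true), x => actBPos (x.1 / 2) (decide (x.1 % 2 = 1)) x.2
  | (b, false), x => actBNeg x
  | (t, δ), x => actT δ x
  | _, x => x

theorem act_compat (p : QGen × Bool) (x : PreState) (h : x.2.IsChain Syl.Compat) :
    (act p x).2.IsChain Syl.Compat := by
  obtain ⟨m, l⟩ := x
  obtain ⟨g, δ⟩ := p
  cases g
  case a => exact h
  case b =>
    cases δ
    · rcases l with _ | ⟨_ | _ | ρ, l⟩ <;> simp_all [act, actBNeg, Syl.Compat]
      exact h.of_cons
    · simp only [act]
      generalize decide (m % 2 = 1) = ρ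
      rcases l with _ | ⟨_ | _ | _, l⟩ <;> cases ρ <;> simp_all [actBPos, Syl.Compat]
      exact h.of_cons
  case t =>
    rcases l with _ | ⟨ε | _ | _, l⟩ <;> cases δ <;> simp_all [act, actT, Syl.Compat]
    all_goals
      cases ε <;> simp_all
    all_goals first | exact h.of_cons | rfl
  all_goals exact h

theorem act_act_not (g : QGen) (δ : Bool) (x : PreState) (h : x.2.IsChain Syl.Compat) :
    act (g, !δ) (act (g, δ) x) = x := by
  obtain ⟨m, l⟩ := x
  cases g
  case a => simp [act]
  case b =>
    cases δ
    · rcases l with _ | ⟨_ | _ | ρ, l⟩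
      case cons.bPos =>
        have h1 : (2 * m + ρ.toInt) / 2 = m := by cases ρ <;> simp; omega
        have h2 : decide ((2 * m + ρ.toInt) % 2 = 1) = ρ := by cases ρ <;> simp
        simp only [act, actBNeg, Bool.not_false, h1, h2]
        rcases l with _ | ⟨_ | _ | _, l⟩ <;> cases ρ <;> simp_all [actBPos, Syl.Compat]
      all_goals simp [act, actBNeg, actBPos]
    · generalize hρ : decide (m % 2 = 1) = ρ
      have h1 : 2 * (m / 2) + ρ.toInt = m := by
        subst hρ
        by_cases hm : m % 2 = 1 <;> simp [hm] <;> omega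
      simp only [act, Bool.not_true, hρ]
      rcases l with _ | ⟨_ | _ | _, l⟩ <;> cases ρ <;> simp_all [actBNeg, actBPos]
      rcases l with _ | ⟨_ | _ | _, l⟩ <;> simp_all [Syl.Compat]
  case t =>
    rcases l with _ | ⟨ε | _ | _, l⟩
    · simp [act, actT]
    · by_cases hε : ε = δ
      · subst hε
        simp [act, actT]
      · obtain rfl : δ = !ε := by cases ε <;> cases δ <;> simp_all
        rcases l with _ | ⟨ε' | _ | _, l⟩ <;> simp_all [act, actT, Syl.Compat]
    · simp [act, actT]
    · simp [act, actT]
  all_goals rfl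

/-- Normal forms of elements of the subgroup `⟨a, b, t⟩`. -/
abbrev State := {x : PreState // x.2.IsChain Syl.Compat}

/-- The permutation of the normal forms given by left multiplication by a generator. -/
def perm (g : QGen) : Equiv.Perm State where
  toFun x := ⟨act (g, true) x, act_compat _ _ x.2⟩
  invFun x := ⟨act (g, false) x, act_compat _ _ x.2⟩
  left_inv x := Subtype.ext (act_act_not g true x x.2)
  right_inv x := Subtype.ext (act_act_not g false x x.2)

theorem coe_perm_apply (g : QGen) (x : State) : (perm g x : PreState) = act (g, true) x := rfl

theorem coe_lift_perm_apply (w : Word QGen) (x : State) :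
    (FreeGroup.lift perm (FreeGroup.mk w) x : PreState) = w.foldr act x := by
  induction w with
  | nil => rfl
  | cons p w ih =>
    obtain ⟨g, δ⟩ := p
    rw [List.foldr_cons, ← ih, FreeGroup.lift_mk, FreeGroup.lift_mk, List.map_cons,
      List.prod_cons]
    cases δ <;> rfl

theorem perm_a_mul_perm_b : perm a * perm b = perm b * perm a * perm a := by
  ext1 ⟨⟨m, l⟩, h⟩
  refine Subtype.ext ?_
  have h1 : (m + 1 + 1) / 2 = m / 2 + 1 := by omega
  have h2 : (m + 1 + 1) % 2 = m % 2 := by omega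
  simp only [Equiv.Perm.mul_apply, coe_perm_apply, act, sgn_true, h1, h2]
  generalize decide (m % 2 = 1) = ρ
  rcases l with _ | ⟨_ | _ | _, l⟩ <;> cases ρ <;> rfl

theorem commute_perm_a_perm_t : Commute (perm a) (perm t) := by
  ext1 ⟨⟨m, l⟩, h⟩
  refine Subtype.ext ?_
  simp only [Equiv.Perm.mul_apply, coe_perm_apply, act, sgn_true]
  rcases l with _ | ⟨ε | _ | _, l⟩ <;> try rfl
  cases ε <;> rfl

/-- The normal form of `tᵏ`. -/
def tSyls (k : ℤ) : List Syl := List.replicate k.natAbs (.t (decide (0 ≤ k)))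

theorem tSyls_injective : Function.Injective tSyls := by
  intro k l h
  have h1 : k.natAbs = l.natAbs := by simpa [tSyls] using congrArg List.length h
  rcases eq_or_ne k 0 with rfl | hk
  · symm; simpa using h1.symm
  · rw [tSyls, tSyls, ← h1, List.replicate_right_inj (by simpa)] at h
    simp only [Syl.t.injEq, decide_eq_decide] at h
    omega

theorem actT_tSyls (m k : ℤ) : actT true (m, tSyls k) = (m, tSyls (k + 1)) := by
  rcases k with (_ | n) | (_ | n)
  · rfl
  · have h1 : tSyls (Int.ofNat (n + 1) + 1) = .t true :: tSyls (Int.ofNat (n + 1)) := by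
      have : (0 : ℤ) ≤ (n + 1 : ℕ) + 1 := by omega
      simp only [tSyls, Int.ofNat_eq_natCast, this, Int.natCast_nonneg, decide_true]
      rfl
    rw [h1]
    rfl
  · rfl
  · rfl

theorem isChain_tSyls (k : ℤ) : (tSyls k).IsChain Syl.Compat := by
  refine List.isChain_replicate_of_rel _ ?_
  simp [Syl.Compat]

theorem perm_t_zpow_apply (m k : ℤ) (h : [].IsChain Syl.Compat) :
    (perm t ^ k) ⟨(m, []), h⟩ = ⟨(m, tSyls k), isChain_tSyls k⟩ := by
  have h1 : ∀ k, perm t ⟨(m, tSyls k), isChain_tSyls k⟩ =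
      ⟨(m, tSyls (k + 1)), isChain_tSyls (k + 1)⟩ := fun k => Subtype.ext (actT_tSyls m k)
  induction k using Int.induction_on with
  | zero => rfl
  | succ k ih => rw [add_comm, zpow_one_add, Equiv.Perm.mul_apply, ih, h1]; simp [add_comm]
  | pred k ih =>
    rw [← Equiv.apply_eq_iff_eq (perm t), ← Equiv.Perm.mul_apply, ← zpow_one_add,
      add_sub_cancel, ih, h1]
    simp

theorem perm_a_zpow_apply (m k : ℤ) (l : List Syl) (h : l.IsChain Syl.Compat) :
    (perm a ^ k) ⟨(m, l), h⟩ = ⟨(m + k, l), h⟩ := by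
  have h1 : ∀ m, perm a ⟨(m, l), h⟩ = ⟨(m + 1, l), h⟩ := fun m => rfl
  induction k using Int.induction_on with
  | zero => simp
  | succ k ih => rw [add_comm, zpow_one_add, Equiv.Perm.mul_apply, ih, h1, add_assoc, add_comm 1]
  | pred k ih =>
    rw [← Equiv.apply_eq_iff_eq (perm a), ← Equiv.Perm.mul_apply, ← zpow_one_add,
      add_sub_cancel, ih, h1, add_assoc, sub_add_cancel]

/-- The normal form of the identity. -/
def baseState : State := ⟨(0, []), List.isChain_nil⟩

theorem perm_zpow_mul_apply (i m : ℤ) :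
    ((perm t ^ i * (perm a * perm t) ^ m) baseState : PreState) = (m, tSyls (i + m)) := by
  rw [commute_perm_a_perm_t.mul_zpow, ← mul_assoc,
    ← (commute_perm_a_perm_t.zpow_zpow m i).eq, mul_assoc, ← zpow_add, Equiv.Perm.mul_apply,
    baseState, perm_t_zpow_apply, perm_a_zpow_apply, zero_add]

theorem eq_zero_of_perm_t_zpow_mem {i : ℤ}
    (h : perm t ^ i ∈ Subgroup.zpowers (perm a * perm t)) : i = 0 := by
  obtain ⟨m, hm⟩ := h
  have h1 := perm_zpow_mul_apply i 0
  have h2 := perm_zpow_mul_apply 0 m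
  simp only [zpow_zero, one_mul, mul_one, zero_add, add_zero] at h1 h2 hm
  rw [← hm, h2, Prod.mk.injEq] at h1
  obtain ⟨rfl, h1⟩ := h1
  exact (tSyls_injective h1).symm

theorem conv_bNeg_aPow {N : ℕ} {m : ℤ} (h : m.natAbs < 2 ^ N) (u : Word QGen) :
    QConv (3 * N + 6 + u.length) ((b, false) :: (aPow m ++ u))
      (aPow (2 * m) ++ (b, false) :: u) := by
  have hl := length_aPow_le h
  obtain ⟨σ, n, rfl⟩ := exists_natPow_eq_aPow m
  rw [mul_left_comm, ← Nat.cast_two, ← Nat.cast_mul, aPow_sgn_mul, aPow_sgn_mul]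
  rw [aPow_sgn_mul] at hl
  rcases eq_or_ne n 0 with rfl | hn
  · simpa using Conv.refl _
  · rw [natPow_two_mul _ hn]
    refine (Conv.cancel b true).symm.step ((b, false) :: natPow σ n) u (by simp)
      (by simp; omega) (Conv.of_eq (by simp))

theorem conv_aPow_aBit (ρ : Bool) {N : ℕ} {m : ℤ} (h : m.natAbs < 2 ^ N) :
    QConv (6 * N + 8) (aPow m ++ aBit ρ) (aPow (m + ρ.toInt)) := by
  cases ρ
  · simpa [aBit] using Conv.refl _
  · simpa [aBit] using conv_aPow_a true h

theorem length_aBit_le (ρ : Bool) : (aBit ρ).length ≤ 1 := by cases ρ <;> simp [aBit]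

theorem conv_bPos_aPow {N : ℕ} (q : ℤ) (ρ : Bool) (h : q.natAbs < 2 ^ N) (u : Word QGen) :
    QConv (6 * N + 16 + u.length) ((b, true) :: (aPow (2 * q + ρ.toInt) ++ u))
      (aPow q ++ (b, true) :: (aBit ρ ++ u)) := by
  have h2 : (2 * q).natAbs < 2 ^ (N + 1) := by rw [pow_succ]; omega
  have hb := length_aBit_le ρ
  refine (conv_aPow_aBit ρ h2).symm.step [(b, true)] u (by simp) (by simp; omega) ?_
  have h3 := (conv_bNeg_aPow h [(b, true)]).trans
    ((Conv.cancel' b true).step (aPow (2 * q)) [] (by simp)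
      (by have := length_aPow_le h2; simp; omega) (Conv.refl _))
  simp only [List.append_nil] at h3
  refine h3.symm.step [(b, true)] (aBit ρ ++ u) (by simp) (by simp; omega) ?_
  exact (Conv.cancel b true).step [] (aPow q ++ (b, true) :: (aBit ρ ++ u)) (by simp)
    (by have := length_aPow_le h; simp; omega) (Conv.refl _)

/-- The generators `a`, `b` and `t`. -/
def IsABT (g : QGen) : Prop := g = a ∨ g = b ∨ g = t

theorem conv_act {g : QGen} (hg : IsABT g) (δ : Bool) (x : PreState) {N : ℕ}
    (h : x.1.natAbs < 2 ^ N) :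
    QConv (6 * N + 20 + (x.2.flatMap Syl.word).length) ((g, δ) :: x.word)
      (act (g, δ) x).word := by
  obtain ⟨m, l⟩ := x
  have hl := length_aPow_le h
  dsimp only at h hl
  rcases hg with rfl | rfl | rfl
  · exact (conv_a_aPow δ h).step [] (l.flatMap Syl.word) rfl (by simp; omega) (Conv.refl _)
  · cases δ
    · refine ((conv_bNeg_aPow h (l.flatMap Syl.word)).mono (by simp; omega)).trans ?_
      have h2 : (2 * m).natAbs < 2 ^ (N + 1) := by rw [pow_succ]; omega
      have hl := length_aPow_le h2
      rcases l with _ | ⟨_ | _ | ρ, l⟩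
      case cons.bPos =>
        refine (Conv.cancel' b true).step (aPow (2 * m)) (aBit ρ ++ l.flatMap Syl.word)
          (by simp [Syl.word]) (by simp [Syl.word]; omega) ?_
        refine (conv_aPow_aBit ρ h2).step [] (l.flatMap Syl.word) (by simp)
          (by simp [Syl.word]; omega) (Conv.refl _)
      all_goals exact Conv.refl _
    · have hm : 2 * (m / 2) + (decide (m % 2 = 1)).toInt = m := by
        by_cases hm : m % 2 = 1 <;> simp [hm] <;> omega
      simp only [act, PreState.word]
      generalize decide (m % 2 = 1) = ρ at hm ⊢
      have hq : (m / 2).natAbs < 2 ^ N := by cases ρ <;> simp at hm <;> omega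
      generalize m / 2 = q at hm hq ⊢
      subst hm
      refine ((conv_bPos_aPow q ρ hq (l.flatMap Syl.word)).mono (by omega)).trans ?_
      have hl := length_aPow_le hq
      rcases l with _ | ⟨_ | _ | _, l⟩ <;> cases ρ
      case cons.bNeg.false =>
        exact (Conv.cancel b true).step (aPow q) (l.flatMap Syl.word)
          (by simp [Syl.word, aBit]) (by simp [Syl.word]; omega) (Conv.refl _)
      all_goals exact Conv.of_eq (by simp [actBPos, Syl.word])
  · refine (conv_t_aPow δ h).step [] (l.flatMap Syl.word) rfl (by simp) ?_
    rcases l with _ | ⟨ε | _ | _, l⟩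
    case cons.t =>
      by_cases hε : ε = δ
      · exact Conv.of_eq (by simp [act, actT, PreState.word, Syl.word, hε])
      · obtain rfl : ε = !δ := by cases ε <;> cases δ <;> simp_all
        exact (Conv.cancel t δ).step (aPow m) (l.flatMap Syl.word)
          (by simp [Syl.word]) (by simp [Syl.word]; omega)
          (Conv.of_eq (by simp [act, actT, PreState.word]))
    all_goals exact Conv.of_eq (by simp [act, actT, PreState.word, Syl.word])

theorem act_size (p : QGen × Bool) (x : PreState) {n : ℕ} (h : x.1.natAbs < 2 ^ n) :
    (act p x).1.natAbs < 2 ^ (n + 1) ∧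
      ((act p x).2.flatMap Syl.word).length ≤ (x.2.flatMap Syl.word).length + 2 := by
  obtain ⟨m, l⟩ := x
  obtain ⟨g, δ⟩ := p
  rw [pow_succ]
  dsimp only at h
  cases g
  case a => cases δ <;> simp [act] <;> omega
  case b =>
    cases δ
    · rcases l with _ | ⟨_ | _ | _ | _, l⟩ <;> simp [act, actBNeg, Syl.word] <;> omega
    · simp only [act]
      generalize decide (m % 2 = 1) = ρ
      rcases l with _ | ⟨_ | _ | _ | _, l⟩ <;> cases ρ <;> simp [actBPos, Syl.word, aBit] <;> omega
  case t =>
    rcases l with _ | ⟨ε | _ | _ | _, l⟩ <;> (try cases ε) <;> cases δ <;>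
      simp [act, actT, Syl.word] <;> omega
  all_goals simp [act]; omega

theorem foldr_act_size (w : Word QGen) :
    (w.foldr act (0, [])).1.natAbs < 2 ^ w.length ∧
      ((w.foldr act (0, [])).2.flatMap Syl.word).length ≤ 2 * w.length := by
  induction w with
  | nil => simp
  | cons p w ih =>
    have := act_size p _ ih.1
    simp only [List.foldr_cons, List.length_cons]
    omega

theorem conv_foldr_act (w : Word QGen) (hw : ∀ p ∈ w, IsABT p.1) :
    QConv (8 * w.length + 20) w (w.foldr act (0, [])).word := by
  induction w with
  | nil => exact Conv.of_eq (by simp [PreState.word])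
  | cons p w ih =>
    obtain ⟨h1, h2⟩ := foldr_act_size w
    have h3 := conv_act (hw p (by simp)) p.2 _ h1
    refine (ih fun q hq => hw q (by simp [hq])).step [p] [] (by simp)
      (by simp; omega) ?_
    simp only [List.append_nil]
    exact h3.mono (by simp only [List.length_cons]; omega)

theorem word_tSyls (m k : ℤ) : PreState.word (m, tSyls k) = aPow m ++ tPow k := by
  simp only [PreState.word, tSyls, tPow]
  congr 1
  induction k.natAbs with
  | zero => rfl
  | succ n ih => simp [List.replicate_succ, ih, Syl.word]

/-- A word in `a`, `b` and `t` whose normal form is `aᵐ tᵏ` can be converted to it. -/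
theorem conv_of_foldr_act_eq (w : Word QGen) (hw : ∀ p ∈ w, IsABT p.1) {m k : ℤ}
    (h : w.foldr act (0, []) = (m, tSyls k)) :
    m.natAbs < 2 ^ w.length ∧ k.natAbs ≤ 2 * w.length ∧
      QConv (8 * w.length + 20) w (aPow m ++ tPow k) := by
  have h1 := foldr_act_size w
  have h2 := conv_foldr_act w hw
  have h3 := congrArg List.length (word_tSyls m k)
  rw [h] at h1 h2
  rw [word_tSyls] at h2
  simp only [PreState.word, List.length_append, length_tPow] at h1 h3
  exact ⟨h1.1, by omega, h2⟩

end QGen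

namespace HNNExtension

open NormalWord

theorem toSubgroup_self {G : Type*} [Group G] (A : Subgroup G) (u : ℤˣ) :
    toSubgroup A A u = A := by
  unfold toSubgroup; split_ifs <;> rfl

/-- An HNN extension in which the stable letter centralizes the associated subgroup. -/
abbrev Centralizing {G : Type*} [Group G] (A : Subgroup G) : Type _ :=
  HNNExtension G A A (MulEquiv.refl A)

namespace Centralizing

section

variable {G : Type*} [Group G] {A : Subgroup G}

theorem commute_of_t {g : G} (hg : g ∈ A) : Commute (of g : Centralizing A) t :=
  (t_mul_of (φ := MulEquiv.refl A) ⟨g, hg⟩).symm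

theorem mem_and_eq_neg_and_mul_eq_one {u v : ℤˣ} {g h : G}
    (H : (t ^ (u : ℤ) * of g * (t ^ (v : ℤ) * of h) : Centralizing A) = 1) :
    g ∈ A ∧ v = -u ∧ g * h = 1 := by
  have h1 : g ∈ A ∧ u ≠ v := by
    by_contra hc
    rw [← Classical.not_imp, not_not] at hc
    let w : ReducedWord G A A := ⟨1, [(u, g), (v, h)], by simpa [toSubgroup_self] using hc⟩
    have := ReducedWord.toList_eq_nil_of_mem_of_range (MulEquiv.refl A) w
      ⟨1, by simpa [w, ReducedWord.prod] using H.symm⟩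
    simp [w] at this
  have h2 : v = -u := by
    rcases Int.units_eq_one_or u with rfl | rfl <;> rcases Int.units_eq_one_or v with rfl | rfl <;>
      simp_all
  refine ⟨h1.1, h2, of_injective (MulEquiv.refl A) ?_⟩
  rw [h2, ← ((commute_of_t h1.1).zpow_right u).eq] at H
  simpa [mul_assoc] using H

end

section

variable {G : Type*} [Group G] {u z : G}

/-- The subgroup generated by the stable letter and an element `u` of the base group. -/
def closurePair (u z : G) : Subgroup (Centralizing (Subgroup.zpowers z)) :=
  Subgroup.closure {of u, t}

theorem of_mem_closurePair : of u ∈ closurePair u z := Subgroup.subset_closure (by simp)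

theorem t_mem_closurePair : t ∈ closurePair u z := Subgroup.subset_closure (by simp)

theorem exists_reducedWord (hu : ∀ i : ℤ, u ^ i ∈ Subgroup.zpowers z → i = 0)
    {g : Centralizing (Subgroup.zpowers z)} (hg : g ∈ closurePair u z) :
    ∃ w : ReducedWord G (Subgroup.zpowers z) (Subgroup.zpowers z),
      w.prod (MulEquiv.refl _) = g ∧ w.head ∈ Subgroup.zpowers u ∧
        ∀ p ∈ w.toList, p.2 ∈ Subgroup.zpowers u := by
  have hof : ∀ (i : ℤ) (w : ReducedWord G (Subgroup.zpowers z) (Subgroup.zpowers z)),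
      w.head ∈ Subgroup.zpowers u → (∀ p ∈ w.toList, p.2 ∈ Subgroup.zpowers u) →
      ∃ w' : ReducedWord G (Subgroup.zpowers z) (Subgroup.zpowers z),
        w'.prod (MulEquiv.refl _) = of (u ^ i) * w.prod (MulEquiv.refl _) ∧
        w'.head ∈ Subgroup.zpowers u ∧ ∀ p ∈ w'.toList, p.2 ∈ Subgroup.zpowers u := by
    intro i w h1 h2
    exact ⟨⟨u ^ i * w.head, w.toList, w.chain⟩, by simp [ReducedWord.prod, mul_assoc],
      mul_mem ⟨i, rfl⟩ h1, h2⟩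
  have ht : ∀ (e : ℤˣ) (w : ReducedWord G (Subgroup.zpowers z) (Subgroup.zpowers z)),
      w.head ∈ Subgroup.zpowers u → (∀ p ∈ w.toList, p.2 ∈ Subgroup.zpowers u) →
      ∃ w' : ReducedWord G (Subgroup.zpowers z) (Subgroup.zpowers z),
        w'.prod (MulEquiv.refl _) = t ^ (e : ℤ) * w.prod (MulEquiv.refl _) ∧
        w'.head ∈ Subgroup.zpowers u ∧ ∀ p ∈ w'.toList, p.2 ∈ Subgroup.zpowers u := by
    rintro e ⟨_, l, hl⟩ ⟨i, rfl⟩ h2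
    dsimp only at h2
    by_cases hc : u ^ i ∈ Subgroup.zpowers z → ∀ p ∈ l.head?, e = p.1
    · refine ⟨⟨1, (e, u ^ i) :: l, List.isChain_cons.2 ⟨fun p hp h => ?_, hl⟩⟩, ?_, one_mem _, ?_⟩
      · exact hc (by simpa [toSubgroup_self] using h) p hp
      · simp [ReducedWord.prod, mul_assoc]
      · simpa using h2
    · push Not at hc
      obtain ⟨h3, ⟨e', g⟩, hp, he⟩ := hc
      obtain rfl := hu i h3
      rcases l with _ | ⟨p, l⟩
      · simp at hp
      · obtain rfl : p = (e', g) := by simpa using hp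
        refine ⟨⟨g, l, (List.isChain_cons.1 hl).2⟩, ?_, h2 (e', g) (by simp),
          fun q hq => h2 q (by simp [hq])⟩
        have : (e' : ℤ) = -e := by
          rcases Int.units_eq_one_or e with rfl | rfl <;>
            rcases Int.units_eq_one_or e' with rfl | rfl <;> simp_all
        simp [ReducedWord.prod, this, mul_assoc]
  have hinv : ((-1 : ℤˣ) : ℤ) = -1 := rfl
  induction hg using Subgroup.closure_induction_left with
  | one => exact ⟨.empty _ _ _, by simp [ReducedWord.prod], one_mem _, by simp⟩
  | mul_left x hx y hy ih =>
    obtain ⟨w, rfl, h1, h2⟩ := ih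
    rcases hx with rfl | rfl
    · simpa using hof 1 w h1 h2
    · simpa using ht 1 w h1 h2
  | inv_mul_cancel x hx y hy ih =>
    obtain ⟨w, rfl, h1, h2⟩ := ih
    rcases hx with rfl | rfl
    · simpa using hof (-1) w h1 h2
    · simpa using ht (-1) w h1 h2

theorem exists_zpow_of_mem_closurePair (hu : ∀ i : ℤ, u ^ i ∈ Subgroup.zpowers z → i = 0)
    {g h : G} {e : ℤˣ} (H : of g * t ^ (e : ℤ) * of h ∈ closurePair u z) :
    ∃ i m j : ℤ, g = u ^ i * z ^ m ∧ h = z ^ (-m) * u ^ j := by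
  obtain ⟨⟨g', l, hl⟩, h1, ⟨i, rfl⟩, h2⟩ := exists_reducedWord hu H
  let w : ReducedWord G (Subgroup.zpowers z) (Subgroup.zpowers z) := ⟨g, [(e, h)], by simp⟩
  obtain ⟨h3, h4⟩ := ReducedWord.map_fst_eq_and_of_prod_eq (MulEquiv.refl _) (w₁ := w)
    (h1.trans (by simp [w, ReducedWord.prod, mul_assoc])).symm
  obtain ⟨j, rfl⟩ : ∃ j : ℤ, l = [(e, u ^ j)] := by
    dsimp only at h2 h3
    clear h1
    rcases l with _ | ⟨⟨e', h'⟩, _ | ⟨p, l⟩⟩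
    · simp [w] at h3
    · obtain ⟨j, hj⟩ := h2 (e', h') (by simp)
      exact ⟨j, by simp_all [w]⟩
    · simp [w] at h3
  obtain ⟨m, hm⟩ : g⁻¹ * u ^ i ∈ Subgroup.zpowers z := by
    simpa [w, toSubgroup_self] using h4
  dsimp only at hm
  rw [eq_inv_mul_iff_mul_eq, ← eq_mul_inv_iff_mul_eq, ← zpow_neg] at hm
  refine ⟨i, -m, j, hm, ?_⟩
  have hz : (t ^ (e : ℤ) * of (z ^ (-m)) : Centralizing (Subgroup.zpowers z)) =
      of (z ^ (-m)) * t ^ (e : ℤ) :=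
    ((commute_of_t (A := Subgroup.zpowers z) ⟨-m, rfl⟩).zpow_right e).eq.symm
  refine of_injective (MulEquiv.refl (Subgroup.zpowers z)) ?_
  simp only [ReducedWord.prod, List.map_cons, List.map_nil, List.prod_cons, List.prod_nil, mul_one,
    hm, map_mul, mul_assoc, mul_right_inj] at h1
  rw [← mul_assoc, ← hz, mul_assoc, mul_right_inj] at h1
  rw [neg_neg, map_mul, h1, ← mul_assoc, ← map_mul, ← zpow_add]
  simp

theorem structure_of_eq_one (hu : ∀ i : ℤ, u ^ i ∈ Subgroup.zpowers z → i = 0)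
    {e₁ e₂ ε₁ ε₂ : ℤˣ} {g₁ h₁ g₂ h₂ : G}
    (H : (t ^ (e₁ : ℤ) * of (of g₁ * t ^ (ε₁ : ℤ) * of h₁) *
      (t ^ (e₂ : ℤ) * of (of g₂ * t ^ (ε₂ : ℤ) * of h₂)) : Centralizing (closurePair u z)) = 1) :
    e₂ = -e₁ ∧ ε₂ = -ε₁ ∧ ∃ i₁ m₁ j₁ i₂ m₂ j₂ : ℤ,
      g₁ = u ^ i₁ * z ^ m₁ ∧ h₁ = z ^ (-m₁) * u ^ j₁ ∧
      g₂ = u ^ i₂ * z ^ m₂ ∧ h₂ = z ^ (-m₂) * u ^ j₂ ∧ j₁ + i₂ = 0 ∧ j₂ + i₁ = 0 := by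
  obtain ⟨hK, he, hmul⟩ := mem_and_eq_neg_and_mul_eq_one H
  obtain ⟨i₁, m₁, j₁, rfl, rfl⟩ := exists_zpow_of_mem_closurePair hu hK
  obtain ⟨i₂, m₂, j₂, rfl, rfl⟩ := exists_zpow_of_mem_closurePair hu
    ((mul_mem_cancel_left hK).1 (hmul ▸ one_mem _))
  have hz : ∀ (m i j : ℤ) (e : ℤˣ), (of (u ^ i * z ^ m) * t ^ (e : ℤ) * of (z ^ (-m) * u ^ j) :
      Centralizing (Subgroup.zpowers z)) = of (u ^ i) * t ^ (e : ℤ) * of (u ^ j) := by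
    intro m i j e
    have := ((commute_of_t (A := Subgroup.zpowers z) ⟨m, rfl⟩).zpow_right e).eq
    rw [map_mul, map_mul, mul_assoc (of (u ^ i)), this, zpow_neg]
    simp [mul_assoc]
  rw [hz, hz] at hmul
  have h1 : (t ^ (ε₁ : ℤ) * of (u ^ (j₁ + i₂)) * (t ^ (ε₂ : ℤ) * of (u ^ (j₂ + i₁))) :
      Centralizing (Subgroup.zpowers z)) = 1 := by
    rw [zpow_add, zpow_add, map_mul, map_mul]
    have := congrArg (fun g => (of (u ^ i₁))⁻¹ * g * of (u ^ i₁)) hmul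
    simpa [mul_assoc] using this
  obtain ⟨h2, h3, h4⟩ := mem_and_eq_neg_and_mul_eq_one h1
  have h5 := hu _ h2
  rw [h5, zpow_zero, one_mul] at h4
  exact ⟨he, h3, i₁, m₁, j₁, i₂, m₂, j₂, rfl, rfl, rfl, rfl, h5, hu _ (h4 ▸ one_mem _)⟩

end

end Centralizing

end HNNExtension

section

variable {A : Type*} [DecidableEq A] {x : A}

theorem countLtr_append (u v : Word A) : countLtr x (u ++ v) = countLtr x u + countLtr x v := by
  simp [countLtr]

theorem countLtr_cons (p : A × Bool) (u : Word A) :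
    countLtr x (p :: u) = (if p.1 = x then 1 else 0) + countLtr x u := by
  by_cases h : p.1 = x <;> simp [countLtr, h, add_comm]

theorem countLtr_eq_zero_iff {w : Word A} : countLtr x w = 0 ↔ ∀ p ∈ w, p.1 ≠ x := by
  simp [countLtr]

theorem exists_eq_of_countLtr_eq_one {w : Word A} (h : countLtr x w = 1) :
    ∃ u ε v, w = u ++ (x, ε) :: v ∧ countLtr x u = 0 ∧ countLtr x v = 0 := by
  have h1 : ∃ ε, (x, ε) ∈ w := by
    by_contra! hc
    rw [countLtr_eq_zero_iff.2] at h
    · simp at h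
    · rintro ⟨y, ε⟩ hp rfl
      exact hc ε hp
  obtain ⟨ε, h1⟩ := h1
  obtain ⟨u, v, rfl⟩ := List.append_of_mem h1
  refine ⟨u, ε, v, rfl, ?_⟩
  simp only [countLtr_append, countLtr_cons, if_true] at h
  omega

end

namespace QGen

open HNNExtension Centralizing

/-- An iterated HNN extension of the permutation group of the normal forms: the first stable
letter centralizes `a t`, and the second one centralizes `t` and the first stable letter. -/
abbrev BassSerre : Type :=
  Centralizing (closurePair (perm t) (perm a * perm t))

/-- The images of the generators of `Q` in `BassSerre`. -/
def gen : QGen → BassSerre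
  | r => of HNNExtension.t
  | s => HNNExtension.t
  | g => of (of (perm g))

theorem lift_gen_eq_one {w : Word QGen} (h : NullHomotopic QRels w) :
    FreeGroup.lift gen (FreeGroup.mk w) = 1 := by
  have hab : gen a * gen b = gen b * gen a * gen a := by
    simp only [gen, ← map_mul, perm_a_mul_perm_b]
  have hat : Commute (gen a) (gen t) := (commute_perm_a_perm_t.map of).map of
  have hr : Commute (gen a * gen t) (gen r) := by
    simpa only [gen, map_mul] using
      (commute_of_t (A := Subgroup.zpowers (perm a * perm t)) (Subgroup.mem_zpowers _)).map of
  have hrs : Commute (gen r) (gen s) := commute_of_t t_mem_closurePair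
  have hts : Commute (gen t) (gen s) := commute_of_t of_mem_closurePair
  have hle : Subgroup.normalClosure (FreeGroup.mk '' QRels) ≤ (FreeGroup.lift gen).ker := by
    refine Subgroup.normalClosure_le_normal ?_
    rintro _ ⟨z, hz, rfl⟩
    rw [SetLike.mem_coe, MonoidHom.mem_ker, FreeGroup.lift_mk]
    simp only [QRels, Set.mem_insert_iff, Set.mem_singleton_iff] at hz
    rcases hz with rfl | rfl | rfl | rfl | rfl <;>
      simp only [List.map_cons, List.map_nil, List.prod_cons, List.prod_nil, cond_true, cond_false,
        mul_one]
    · rw [← mul_assoc (gen a) (gen b), hab]; group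
    · rw [← hat.eq]; group
    · rw [← hr.eq]; group
    · rw [hrs.eq]; group
    · rw [← hts.eq]; group
  exact hle h

theorem lift_gen_mk (w : Word QGen) (hw : ∀ p ∈ w, IsABT p.1) :
    FreeGroup.lift gen (FreeGroup.mk w) = of (of (FreeGroup.lift perm (FreeGroup.mk w))) := by
  have : (of.comp of : Equiv.Perm State →* BassSerre).comp (FreeGroup.lift perm) =
      FreeGroup.lift fun g => of (of (perm g)) := by
    ext; simp
  rw [← MonoidHom.comp_apply, ← MonoidHom.comp_apply, this, FreeGroup.lift_mk, FreeGroup.lift_mk]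
  congr 1
  refine List.map_congr_left fun p hp => ?_
  obtain ⟨g, δ⟩ := p
  rcases hw _ hp with h | h | h <;> dsimp only at h <;> subst h <;> rfl

/-- The sign of a letter, as a unit of `ℤ`. -/
def unitSgn (δ : Bool) : ℤˣ := if δ then 1 else -1

theorem lift_gen_mk_cons (g : QGen) (δ : Bool) (w : Word QGen) :
    FreeGroup.lift gen (FreeGroup.mk ((g, δ) :: w)) =
      gen g ^ (unitSgn δ : ℤ) * FreeGroup.lift gen (FreeGroup.mk w) := by
  cases δ <;> simp [unitSgn]

theorem lift_gen_mk_append (u v : Word QGen) :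
    FreeGroup.lift gen (FreeGroup.mk (u ++ v)) =
      FreeGroup.lift gen (FreeGroup.mk u) * FreeGroup.lift gen (FreeGroup.mk v) := by
  rw [← FreeGroup.mul_mk, map_mul]

theorem eq_not_of_unitSgn {δ ε : Bool} (h : unitSgn ε = -unitSgn δ) : ε = !δ := by
  revert δ ε; decide

theorem conv_of_lift_perm_eq {w : Word QGen} (hw : ∀ p ∈ w, IsABT p.1) {m i : ℤ}
    (h : FreeGroup.lift perm (FreeGroup.mk w) = perm t ^ i * (perm a * perm t) ^ m) :
    m.natAbs < 2 ^ w.length ∧ (i + m).natAbs ≤ 2 * w.length ∧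
      QConv (8 * w.length + 20) w (aPow m ++ tPow (i + m)) := by
  refine conv_of_foldr_act_eq w hw ?_
  rw [← perm_zpow_mul_apply, ← h, coe_lift_perm_apply]
  rfl

theorem conv_of_lift_perm_eq_conj {u v : Word QGen} (hu : ∀ p ∈ u, IsABT p.1)
    (hv : ∀ p ∈ v, IsABT p.1) (ε : Bool) {n : ℕ} (hn : u.length + v.length + 1 ≤ n) {i m j : ℤ}
    (h₁ : FreeGroup.lift perm (FreeGroup.mk u) = perm t ^ i * (perm a * perm t) ^ m)
    (h₂ : FreeGroup.lift perm (FreeGroup.mk v) = (perm a * perm t) ^ (-m) * perm t ^ j) :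
    m.natAbs < 2 ^ n ∧ (i + m).natAbs ≤ 2 * n ∧ (j - m).natAbs ≤ 2 * n ∧
      QConv (9 * n + 30) (u ++ (r, ε) :: v) (block ε (i + m) m (j - m)) := by
  have hc : Commute (perm a * perm t) (perm t) := commute_perm_a_perm_t.mul_left (.refl _)
  rw [(hc.zpow_zpow (-m) j).eq] at h₂
  obtain ⟨hm, hk, h₃⟩ := conv_of_lift_perm_eq hu h₁
  obtain ⟨hm', hl, h₄⟩ := conv_of_lift_perm_eq hv h₂
  rw [← sub_eq_add_neg] at h₄ hl
  have h₅ := conv_tPow_aPow (i + m) hm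
  refine ⟨hm.trans_le (Nat.pow_le_pow_right two_pos (by omega)), by omega, by omega, ?_⟩
  refine h₃.step [] ((r, ε) :: v) (by simp) (by simp; omega) ?_
  refine h₅.symm.step [] ((r, ε) :: v) (by simp) (by simp; omega) ?_
  have := length_aPow_le hm
  refine h₄.step (tPow (i + m) ++ aPow m ++ [(r, ε)]) [] (by simp) ?_
    (Conv.of_eq (by simp [block, conjR]))
  simp only [List.length_append, List.length_cons, List.length_nil, length_tPow]
  omega

theorem isABT_of_countLtr_eq_zero {w : Word QGen} (hr : countLtr r w = 0) (hs : countLtr s w = 0) :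
    ∀ p ∈ w, IsABT p.1 := by
  rw [countLtr_eq_zero_iff] at hr hs
  intro p hp
  have h1 := hr p hp
  have h2 := hs p hp
  rcases p with ⟨_ | _ | _ | _ | _, δ⟩ <;> simp_all [IsABT]

theorem convC_nil_of_alternating {u₁ v₁ u₂ v₂ : Word QGen} {e₁ e₂ ε₁ ε₂ : Bool}
    (hu₁ : ∀ p ∈ u₁, IsABT p.1) (hv₁ : ∀ p ∈ v₁, IsABT p.1)
    (hu₂ : ∀ p ∈ u₂, IsABT p.1) (hv₂ : ∀ p ∈ v₂, IsABT p.1)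
    (H : FreeGroup.lift gen (FreeGroup.mk ((s, e₁) :: ((u₁ ++ (r, ε₁) :: v₁) ++
      (s, e₂) :: (u₂ ++ (r, ε₂) :: v₂)))) = 1)
    {n : ℕ} (hn : u₁.length + v₁.length + u₂.length + v₂.length + 4 = n) :
    ConvC QRels (100 * n) ((s, e₁) :: ((u₁ ++ (r, ε₁) :: v₁) ++
      (s, e₂) :: (u₂ ++ (r, ε₂) :: v₂))) [] := by
  simp only [lift_gen_mk_cons, lift_gen_mk_append, lift_gen_mk _ hu₁, lift_gen_mk _ hv₁,
    lift_gen_mk _ hu₂, lift_gen_mk _ hv₂] at H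
  obtain ⟨he, hε, i₁, m₁, j₁, i₂, m₂, j₂, h₁, h₂, h₃, h₄, h₅, h₆⟩ :=
    structure_of_eq_one (e₁ := unitSgn e₁) (e₂ := unitSgn e₂) (ε₁ := unitSgn ε₁)
      (ε₂ := unitSgn ε₂) (g₁ := FreeGroup.lift perm (FreeGroup.mk u₁))
      (h₁ := FreeGroup.lift perm (FreeGroup.mk v₁)) (g₂ := FreeGroup.lift perm (FreeGroup.mk u₂))
      (h₂ := FreeGroup.lift perm (FreeGroup.mk v₂)) (fun _ => eq_zero_of_perm_t_zpow_mem) (by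
      rw [← H]; simp only [gen, map_mul, map_zpow, mul_assoc])
  obtain rfl := eq_not_of_unitSgn he
  obtain rfl := eq_not_of_unitSgn hε
  obtain ⟨hm₁, hk₁, hl₁, hc₁⟩ := conv_of_lift_perm_eq_conj hu₁ hv₁ ε₁ (n := n) (by omega) h₁ h₂
  obtain ⟨hm₂, hk₂, hl₂, hc₂⟩ := conv_of_lift_perm_eq_conj hu₂ hv₂ (!ε₁) (n := n) (by omega) h₃ h₄
  have hpow : 2 ^ n + 2 * (2 * n) ≤ 2 ^ (3 * n) := by
    have h1 : n < 2 ^ n := Nat.lt_two_pow_self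
    have h2 : 2 ^ 4 ≤ 2 ^ n := Nat.pow_le_pow_right two_pos (by omega)
    rw [mul_comm 3, pow_mul]
    nlinarith [Nat.mul_le_mul h2 h2]
  have hfin := convC_block_block (N := 3 * n) (D := 2 * n) e₁ ε₁ (k₂ := j₁ - m₁) (m := m₁)
    (k₃ := i₂ + m₂) (m' := m₂) (k₁ := i₁ + m₁) (k₄ := j₂ - m₂) (by omega) (by omega)
    (by omega) (by omega) (by omega) (by omega) (by omega) (by omega)
  have hb := length_block_le ε₁ (i₁ + m₁) (j₁ - m₁) hm₁
  refine (Conv.convC ?_).trans (hfin.mono (by omega))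
  refine hc₁.step [(s, e₁)] ((s, !e₁) :: (u₂ ++ (r, !ε₁) :: v₂)) (by simp) (by simp; omega) ?_
  refine hc₂.step ((s, e₁) :: (block ε₁ (i₁ + m₁) m₁ (j₁ - m₁) ++ [(s, !e₁)])) [] (by simp) ?_
    (Conv.of_eq (by simp))
  simp only [List.length_append, List.length_cons, List.length_nil]
  omega

end QGen

theorem FFL_linear_of_alternating :
    ∃ C : ℕ, 0 < C ∧ ∀ w : Word QGen, NullHomotopic QRels w →
      countLtr QGen.r w = 2 → countLtr QGen.s w = 2 →
      (∃ (w₁ w₂ w₃ : Word QGen) (b₁ b₂ : Bool),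
        w = w₁ ++ (QGen.s, b₁) :: (w₂ ++ (QGen.s, b₂) :: w₃) ∧ countLtr QGen.r w₂ = 1) →
      FFLle QRels w (C * w.length) := by
  refine ⟨100, by norm_num, ?_⟩
  rintro w hw hr hs ⟨w₁, w₂, w₃, b₁, b₂, rfl, hr₂⟩
  simp only [countLtr_append, countLtr_cons, if_true, reduceCtorEq, if_false] at hr hs
  have hr' : countLtr QGen.r (w₃ ++ w₁) = 1 := by rw [countLtr_append]; omega
  obtain ⟨u₁, ε₁, v₁, rfl, hu₁, hv₁⟩ := exists_eq_of_countLtr_eq_one hr₂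
  obtain ⟨u₂, ε₂, v₂, hw', hu₂, hv₂⟩ := exists_eq_of_countLtr_eq_one hr'
  have hs' := congrArg (countLtr QGen.s) hw'
  have hl := congrArg List.length hw'
  simp only [countLtr_append, countLtr_cons, reduceCtorEq, if_false, List.length_append,
    List.length_cons] at hs hs' hl
  have H := QGen.lift_gen_eq_one hw
  rw [QGen.lift_gen_mk_append, mul_eq_one_comm, ← QGen.lift_gen_mk_append] at H
  simp only [List.cons_append, List.append_assoc, hw'] at H
  refine ConvC.ffle ?_ (by omega)
  refine (ConvC.rotate _ _ (by rw [List.length_append]; omega)).trans ?_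
  have h := QGen.convC_nil_of_alternating (QGen.isABT_of_countLtr_eq_zero hu₁ (by omega))
    (QGen.isABT_of_countLtr_eq_zero hv₁ (by omega)) (QGen.isABT_of_countLtr_eq_zero hu₂ (by omega))
    (QGen.isABT_of_countLtr_eq_zero hv₂ (by omega)) (by simpa using H) rfl
  simp only [List.cons_append, List.append_assoc, hw'] at h ⊢
  exact h.mono (by simp only [List.length_append, List.length_cons]; omega)
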